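/- There exists a set of twelve vertices of the Tutte graph T such that, declaring exactly those twelve vertices negative and all other vertices positive, the resulting vertex-signed graph T has no consistent 2-factor. -/

import Mathlib

/-- A *2-factor* of `G`: a spanning subgraph in which every vertex has degree `2`. -/
def IsTwoFactor {V : Type*} (G F : SimpleGraph V) : Prop :=
  F ≤ G ∧ ∀ v : V, (F.neighborSet v).ncard = 2

/-- A 2-factor `F` of a vertex-signed graph is *consistent* if every cycle (connected
component) of `F` contains an even number of positive vertices. -/
def IsConsistentTwoFactor {V : Type*} (G F : SimpleGraph V) (pos : V → Prop) : Prop :=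
  IsTwoFactor G F ∧
    ∀ K : F.ConnectedComponent,
      Even {v : V | F.connectedComponentMk v = K ∧ pos v}.ncard

/-- The edges of the Tutte graph, Tutte's non-Hamiltonian 3-connected cubic planar
graph on 46 vertices.  It is obtained from `K₄` by replacing three of its vertices by
copies of Tutte's fragment: the fragments occupy the vertices `15*t, …, 15*t + 14`
(`t = 0, 1, 2`), vertex `45` is the central vertex of `K₄`, joined to the compulsory
boundary vertex `15*t + 14` of each fragment, and the remaining boundary vertices
(`15*t + 10` and `15*t + 12`) of the fragments are joined cyclically. -/
def tutteGraphEdges : List (Fin 46 × Fin 46) :=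
  [(0,1), (0,2), (0,3), (1,4), (1,9), (2,5), (2,6), (3,7), (3,8), (4,5), (4,11),
   (5,13), (6,7), (6,13), (7,14), (8,9), (8,14), (9,12), (10,11), (10,13), (11,12),
   (45,14), (10,27),
   (15,16), (15,17), (15,18), (16,19), (16,24), (17,20), (17,21), (18,22), (18,23),
   (19,20), (19,26), (20,28), (21,22), (21,28), (22,29), (23,24), (23,29), (24,27),
   (25,26), (25,28), (26,27), (45,29), (25,42),
   (30,31), (30,32), (30,33), (31,34), (31,39), (32,35), (32,36), (33,37), (33,38),
   (34,35), (34,41), (35,43), (36,37), (36,43), (37,44), (38,39), (38,44), (39,42),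
   (40,41), (40,43), (41,42), (45,44), (40,12)]

/-- The Tutte graph. -/
def tutteGraph : SimpleGraph (Fin 46) :=
  SimpleGraph.fromRel (fun i j => (i, j) ∈ tutteGraphEdges)

section EvenDegree

variable {V : Type*} {G F : SimpleGraph V}

/-- At a vertex all of whose neighbours are among `a`, `b`, `c`, a 2-factor omits exactly one of
the three edges. -/
theorem IsTwoFactor.adj_of_neighbors (hF : IsTwoFactor G F) {v a b c : V}
    (hN : ∀ w, G.Adj v w → w ∈ [a, b, c]) (hd : [a, b, c].Nodup) :
    (F.Adj v a ∧ F.Adj v b ∧ ¬ F.Adj v c) ∨ (F.Adj v a ∧ ¬ F.Adj v b ∧ F.Adj v c) ∨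
      (¬ F.Adj v a ∧ F.Adj v b ∧ F.Adj v c) := by
  obtain ⟨x, y, hxy, hset⟩ := Set.ncard_eq_two.mp (hF.2 v)
  have key (w : V) : F.Adj v w ↔ w = x ∨ w = y := by
    rw [← SimpleGraph.mem_neighborSet, hset]
    simp
  have hx := hN x (hF.1 ((key x).2 (.inl rfl)))
  have hy := hN y (hF.1 ((key y).2 (.inr rfl)))
  simp only [key, List.nodup_cons, List.mem_cons, List.not_mem_nil, or_false] at *
  grind

/-- In a consistent 2-factor, every union of components has an even number of positive
vertices. -/
theorem IsConsistentTwoFactor.even_card_filter [Fintype V] {pos : V → Prop} [DecidablePred pos]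
    (hF : IsConsistentTwoFactor G F pos) (S : Finset V)
    (hS : ∀ u ∈ S, ∀ w, F.Adj u w → w ∈ S) : Even (S.filter pos).card := by
  classical
  have closed {u w : V} (h : F.Reachable u w) : u ∈ S → w ∈ S := by
    obtain ⟨p⟩ := h
    induction p with
    | nil => exact id
    | cons hadj _ ih => exact fun hu => ih (hS _ hu _ hadj)
  rw [Finset.card_eq_sum_card_image F.connectedComponentMk]
  refine Finset.even_sum _ fun K hK => ?_
  obtain ⟨u, hu, rfl⟩ := Finset.mem_image.mp hK
  refine (congrArg Even ?_).mpr (hF.2 (F.connectedComponentMk u))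
  rw [← Set.ncard_coe_finset]
  congr 1
  ext w
  simp only [Finset.coe_filter, Finset.mem_filter, Set.mem_ofPred_eq]
  constructor
  · rintro ⟨⟨-, hw⟩, h⟩
    exact ⟨h, hw⟩
  · rintro ⟨h, hw⟩
    exact ⟨⟨closed (SimpleGraph.ConnectedComponent.exact h).symm (Finset.mem_filter.mp hu).1,
      hw⟩, h⟩

end EvenDegree

/-- The `i`-th vertex of the `t`-th fragment of the Tutte graph. -/
def fragmentVertex (t : Fin 3) (i : Fin 15) : Fin 46 :=
  ⟨15 * t + i, by omega⟩

/-- The neighbours of the vertices of a fragment. -/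
def fragmentNeighbors (t : Fin 3) : Fin 15 → List (Fin 46) :=
  let f := fragmentVertex t
  ![[f 1, f 2, f 3],
    [f 0, f 4, f 9],
    [f 0, f 5, f 6],
    [f 0, f 7, f 8],
    [f 1, f 5, f 11],
    [f 2, f 4, f 13],
    [f 2, f 7, f 13],
    [f 3, f 6, f 14],
    [f 3, f 9, f 14],
    [f 1, f 8, f 12],
    [f 11, f 13, fragmentVertex (t + 1) 12],
    [f 4, f 10, f 12],
    [f 9, f 11, fragmentVertex (t + 2) 10],
    [f 5, f 6, f 10],
    [f 7, f 8, 45]]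

/-- Four vertices in each fragment, chosen negative. -/
def tutteNegative : Finset (Fin 46) :=
  {1, 2, 3, 10, 16, 17, 18, 25, 31, 32, 33, 40}

theorem mem_fragmentNeighbors (t : Fin 3) (i : Fin 15) (w : Fin 46)
    (h : tutteGraph.Adj (fragmentVertex t i) w) : w ∈ fragmentNeighbors t i := by
  have key : ∀ t i, ∀ e ∈ tutteGraphEdges,
      (e.1 = fragmentVertex t i → e.2 ∈ fragmentNeighbors t i) ∧
      (e.2 = fragmentVertex t i → e.1 ∈ fragmentNeighbors t i) := by
    decide +kernel
  obtain ⟨-, h | h⟩ := h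
  · exact (key t i _ h).1 rfl
  · exact (key t i _ h).2 rfl

theorem nodup_fragmentNeighbors (t : Fin 3) (i : Fin 15) : (fragmentNeighbors t i).Nodup := by
  revert t i
  decide +kernel

theorem mem_centralNeighbors (w : Fin 46) (h : tutteGraph.Adj 45 w) :
    w ∈ [fragmentVertex 0 14, fragmentVertex 1 14, fragmentVertex 2 14] := by
  revert w
  simp only [tutteGraph, SimpleGraph.fromRel_adj]
  decide +kernel

/-- If a set of fragment vertices contains an odd number of positive vertices, then a consistent
2-factor uses one of the edges leaving it. -/
theorem exists_boundary_adj {F : SimpleGraph (Fin 46)}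
    (hF : IsConsistentTwoFactor tutteGraph F (fun v => v ∉ tutteNegative)) (t : Fin 3)
    (S : Finset (Fin 15)) (L : Fin 3 → List (Fin 15 × Fin 46))
    (hL : ∀ t, ∀ i ∈ S, ∀ w ∈ fragmentNeighbors t i,
      w ∉ S.image (fragmentVertex t) → (i, w) ∈ L t)
    (hodd : ∀ t, Odd ((S.image (fragmentVertex t)).filter (· ∉ tutteNegative)).card) :
    ∃ p ∈ L t, F.Adj (fragmentVertex t p.1) p.2 := by
  by_contra! hcon
  refine Nat.not_even_iff_odd.mpr (hodd t) (hF.even_card_filter _ fun u hu w huw => ?_)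
  by_contra hw
  obtain ⟨i, hi, rfl⟩ := Finset.mem_image.mp hu
  exact hcon _ (hL t i hi w (mem_fragmentNeighbors t i w (hF.1.1 huw)) hw) huw

/-- In a consistent 2-factor, every fragment uses its compulsory edge. -/
theorem adj_central {F : SimpleGraph (Fin 46)}
    (hF : IsConsistentTwoFactor tutteGraph F (fun v => v ∉ tutteNegative)) (t : Fin 3) :
    F.Adj (fragmentVertex t 14) 45 := by
  by_contra h14
  have d0 := hF.1.adj_of_neighbors (mem_fragmentNeighbors t 0) (nodup_fragmentNeighbors t 0)
  have d1 := hF.1.adj_of_neighbors (mem_fragmentNeighbors t 1) (nodup_fragmentNeighbors t 1)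
  have d2 := hF.1.adj_of_neighbors (mem_fragmentNeighbors t 2) (nodup_fragmentNeighbors t 2)
  have d3 := hF.1.adj_of_neighbors (mem_fragmentNeighbors t 3) (nodup_fragmentNeighbors t 3)
  have d4 := hF.1.adj_of_neighbors (mem_fragmentNeighbors t 4) (nodup_fragmentNeighbors t 4)
  have d5 := hF.1.adj_of_neighbors (mem_fragmentNeighbors t 5) (nodup_fragmentNeighbors t 5)
  have d6 := hF.1.adj_of_neighbors (mem_fragmentNeighbors t 6) (nodup_fragmentNeighbors t 6)
  have d7 := hF.1.adj_of_neighbors (mem_fragmentNeighbors t 7) (nodup_fragmentNeighbors t 7)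
  have d8 := hF.1.adj_of_neighbors (mem_fragmentNeighbors t 8) (nodup_fragmentNeighbors t 8)
  have d9 := hF.1.adj_of_neighbors (mem_fragmentNeighbors t 9) (nodup_fragmentNeighbors t 9)
  have d10 := hF.1.adj_of_neighbors (mem_fragmentNeighbors t 10) (nodup_fragmentNeighbors t 10)
  have d11 := hF.1.adj_of_neighbors (mem_fragmentNeighbors t 11) (nodup_fragmentNeighbors t 11)
  have d12 := hF.1.adj_of_neighbors (mem_fragmentNeighbors t 12) (nodup_fragmentNeighbors t 12)
  have d13 := hF.1.adj_of_neighbors (mem_fragmentNeighbors t 13) (nodup_fragmentNeighbors t 13)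
  have d14 := hF.1.adj_of_neighbors (mem_fragmentNeighbors t 14) (nodup_fragmentNeighbors t 14)
  have c0 := exists_boundary_adj hF t {0, 1, 2, 3, 4, 5, 6, 7, 8, 9, 13, 14}
    (fun t => [(4, fragmentVertex t 11), (9, fragmentVertex t 12), (13, fragmentVertex t 10),
      (14, 45)])
    (by decide +kernel) (by decide +kernel)
  have c1 := exists_boundary_adj hF t {0, 2, 3, 5, 6, 7, 8, 13, 14}
    (fun t => [(0, fragmentVertex t 1), (5, fragmentVertex t 4), (8, fragmentVertex t 9),
      (13, fragmentVertex t 10), (14, 45)])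
    (by decide +kernel) (by decide +kernel)
  have c2 := exists_boundary_adj hF t {0, 1, 3, 7, 8, 9, 14}
    (fun t => [(0, fragmentVertex t 2), (1, fragmentVertex t 4), (7, fragmentVertex t 6),
      (9, fragmentVertex t 12), (14, 45)])
    (by decide +kernel) (by decide +kernel)
  have c3 := exists_boundary_adj hF t {2, 5, 6, 13}
    (fun t => [(2, fragmentVertex t 0), (5, fragmentVertex t 4), (6, fragmentVertex t 7),
      (13, fragmentVertex t 10)])
    (by decide +kernel) (by decide +kernel)
  have c4 := exists_boundary_adj hF t {3, 7, 8, 14}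
    (fun t => [(3, fragmentVertex t 0), (7, fragmentVertex t 6), (8, fragmentVertex t 9), (14, 45)])
    (by decide +kernel) (by decide +kernel)
  have c5 := exists_boundary_adj hF t {0, 1, 2, 3, 4, 5, 6, 7, 8, 9, 10, 11, 12, 13, 14}
    (fun t => [(10, fragmentVertex (t + 1) 12), (12, fragmentVertex (t + 2) 10), (14, 45)])
    (by decide +kernel) (by decide +kernel)
  simp only [List.mem_cons, List.not_mem_nil, or_false, exists_eq_or_imp, exists_eq_left,
    h14] at *
  simp only [F.adj_comm] at *
  grind

/-- **A signed Tutte graph without any consistent 2-factor.**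
There exists a set of twelve vertices of the Tutte graph such that, declaring exactly
those twelve vertices negative and all other vertices positive, the resulting
vertex-signed graph has no consistent 2-factor. -/
theorem tutte_graph_no_consistent_two_factor :
    ∃ neg : Finset (Fin 46), neg.card = 12 ∧
      ¬ ∃ F : SimpleGraph (Fin 46),
          IsConsistentTwoFactor tutteGraph F (fun v => v ∉ neg) := by
  refine ⟨tutteNegative, by decide, ?_⟩
  rintro ⟨F, hF⟩
  have h0 := (adj_central hF 0).symm
  have h1 := (adj_central hF 1).symm
  have h2 := (adj_central hF 2).symm
  have := hF.1.adj_of_neighbors mem_centralNeighbors (by decide)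
  tauto
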